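/- arXiv:1909.07178 — 4 statements merged into one kernel-verified Lean document; each statement's English description precedes it below -/
import Mathlib

section
/- Let a, b ∈ (−1, 1), a ≠ b, and s₀ ∈ (0, 1). For n ∈ ℕ and j > ⌊n s₀⌋ let σ_{n,j}² = b^{2(j−⌊n s₀⌋)}/(1−a²) + Σ_{i=0}^{j−⌊n s₀⌋−1} b^{2i}, and define R_n(x) = (1/n) Σ_{j=⌊n s₀⌋+1}^{n} ( φ_{σ_{n,j}²}(x) − φ_{1/(1−b²)}(x) ), where φ_v is the density of N(0, v). Then R_n(x) → 0 as n → ∞ for every x ∈ ℝ. (This verifies assumption (X3) of the paper for the AR(1) model with one change in the autoregression coefficient.) -/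
open Filter

/-- The density of the centered normal distribution `N(0, v)` with variance `v`. -/
noncomputable def gaussDensity (v x : ℝ) : ℝ :=
  (Real.sqrt (2 * Real.pi * v))⁻¹ * Real.exp (-x ^ 2 / (2 * v))

/-- Verification of assumption (X3) for the AR(1) model with one change in the autoregression
coefficient: the deviation `R_n(x)` of the average post-change marginal density from the
post-change stationary density tends to zero pointwise. -/
theorem ar1_X3_verification (a b : ℝ) (ha : a ∈ Set.Ioo (-1 : ℝ) 1)
    (hb : b ∈ Set.Ioo (-1 : ℝ) 1) (hab : a ≠ b) (s₀ : ℝ) (hs₀ : s₀ ∈ Set.Ioo (0 : ℝ) 1)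
    (k₀ : ℕ → ℕ) (hk₀ : ∀ n : ℕ, k₀ n = ⌊(n : ℝ) * s₀⌋₊)
    (σsq : ℕ → ℕ → ℝ)
    (hσsq : ∀ n j : ℕ, σsq n j =
      b ^ (2 * (j - k₀ n)) / (1 - a ^ 2) + ∑ i ∈ Finset.range (j - k₀ n), b ^ (2 * i))
    (R : ℕ → ℝ → ℝ)
    (hR : ∀ (n : ℕ) (x : ℝ), R n x =
      (1 / (n : ℝ)) * ∑ j ∈ Finset.Ioc (k₀ n) n,
        (gaussDensity (σsq n j) x - gaussDensity (1 / (1 - b ^ 2)) x)) :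
    ∀ x : ℝ, Tendsto (fun n : ℕ => R n x) atTop (nhds 0) := by
  intro x
  set v : ℕ → ℝ := fun m => b ^ (2 * m) / (1 - a ^ 2) + ∑ i ∈ Finset.range m, b ^ (2 * i) with hv
  set g : ℕ → ℝ := fun m => gaussDensity (v m) x - gaussDensity (1 / (1 - b ^ 2)) x with hg
  have hb1 : b ^ 2 < 1 := by nlinarith [hb.1, hb.2]
  have hb0 : 0 ≤ b ^ 2 := sq_nonneg b
  have hw : 0 < 1 / (1 - b ^ 2) := by
    apply one_div_pos.mpr; linarith
  have hvt : Tendsto v atTop (nhds (1 / (1 - b ^ 2))) := by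
    have h1 := (tendsto_pow_atTop_nhds_zero_of_lt_one hb0 hb1).div_const (1 - a ^ 2)
    have h2 := (hasSum_geometric_of_lt_one hb0 hb1).tendsto_sum_nat
    have h3 := h1.add h2
    simpa [hv, pow_mul] using h3
  have hc : ContinuousAt (fun v => gaussDensity v x) (1 / (1 - b ^ 2)) := by
    unfold gaussDensity
    have h1 : Real.sqrt (2 * Real.pi * (1 / (1 - b ^ 2))) ≠ 0 := by
      have := Real.pi_pos
      positivity
    have h2 : 2 * (1 / (1 - b ^ 2)) ≠ 0 := by positivity
    apply ContinuousAt.mul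
    · exact ContinuousAt.inv₀ (by fun_prop) h1
    · apply ContinuousAt.rexp
      exact ContinuousAt.div (by fun_prop) (by fun_prop) h2
  have hgt : Tendsto g atTop (nhds 0) := by
    have := (hc.tendsto.comp hvt).sub_const (gaussDensity (1 / (1 - b ^ 2)) x)
    simpa [hg, Function.comp_def] using this
  have habs : Tendsto (fun m => |g (m + 1)|) atTop (nhds 0) := by
    have := (hgt.comp (tendsto_add_atTop_nat 1)).abs
    simpa [Function.comp_def] using this
  have hces := habs.cesaro
  refine squeeze_zero_norm (fun n => ?_) hces
  have hsum : ∑ j ∈ Finset.Ioc (k₀ n) n,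
        (gaussDensity (σsq n j) x - gaussDensity (1 / (1 - b ^ 2)) x)
      = ∑ i ∈ Finset.range (n - k₀ n), g (i + 1) := by
    have he : Finset.Ioc (k₀ n) n = Finset.Ico (k₀ n + 1) (n + 1) := by
      ext j; simp only [Finset.mem_Ioc, Finset.mem_Ico]; omega
    rw [he, Finset.sum_Ico_eq_sum_range, Nat.add_sub_add_right]
    refine Finset.sum_congr rfl (fun i _ => ?_)
    rw [hσsq, show k₀ n + 1 + i - k₀ n = i + 1 by omega]
  rw [hR, hsum, Real.norm_eq_abs, abs_mul, abs_of_nonneg (by positivity), one_div]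
  refine mul_le_mul_of_nonneg_left ?_ (by positivity)
  refine (Finset.abs_sum_le_sum_abs _ _).trans ?_
  exact Finset.sum_le_sum_of_subset_of_nonneg
    (Finset.range_mono (Nat.sub_le _ _)) (fun _ _ _ => abs_nonneg _)
end

section
/- Let s₀ ∈ (0, 1) and n ∈ ℕ with 0 < ⌊n s₀⌋ < n, and define Δ_{n,1}(s) = 1{s ≤ s₀}·((n−⌊n s₀⌋)/n)·(⌊ns⌋/n) + 1{s > s₀}·((n−⌊ns⌋)/n)·(⌊n s₀⌋/n) for s ∈ [0, 1]. Then Δ_{n,1}(s₀) > 0 and for every s ∈ [0, 1]: 1 − Δ_{n,1}(s)/Δ_{n,1}(s₀) ≥ min( n/⌊n s₀⌋, n/(n−⌊n s₀⌋) ) · | ⌊ns⌋/n − ⌊n s₀⌋/n | ≥ | ⌊ns⌋/n − ⌊n s₀⌋/n |. -/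
/-- Key inequality for the rate of convergence (Theorem 2): `Δ_{n,1}(s₀) > 0` and
`1 − Δ_{n,1}(s)/Δ_{n,1}(s₀) ≥ min(n/⌊ns₀⌋, n/(n−⌊ns₀⌋))·|⌊ns⌋/n − ⌊ns₀⌋/n| ≥ |⌊ns⌋/n − ⌊ns₀⌋/n|`. -/
theorem drift_factor_separation_inequality (s₀ : ℝ) (hs₀ : s₀ ∈ Set.Ioo (0 : ℝ) 1)
    (n : ℕ) (hfloor_pos : 0 < ⌊(n : ℝ) * s₀⌋₊) (hfloor_lt : ⌊(n : ℝ) * s₀⌋₊ < n)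
    (Δn : ℝ → ℝ)
    (hΔn : ∀ s : ℝ, Δn s =
      if s ≤ s₀ then ((n : ℝ) - ⌊(n : ℝ) * s₀⌋₊) / n * ((⌊(n : ℝ) * s⌋₊ : ℝ) / n)
      else ((n : ℝ) - ⌊(n : ℝ) * s⌋₊) / n * ((⌊(n : ℝ) * s₀⌋₊ : ℝ) / n)) :
    0 < Δn s₀ ∧
    ∀ s ∈ Set.Icc (0 : ℝ) 1,
      min ((n : ℝ) / ⌊(n : ℝ) * s₀⌋₊) ((n : ℝ) / ((n : ℝ) - ⌊(n : ℝ) * s₀⌋₊)) *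
          |(⌊(n : ℝ) * s⌋₊ : ℝ) / n - (⌊(n : ℝ) * s₀⌋₊ : ℝ) / n|
        ≤ 1 - Δn s / Δn s₀ ∧
      |(⌊(n : ℝ) * s⌋₊ : ℝ) / n - (⌊(n : ℝ) * s₀⌋₊ : ℝ) / n|
        ≤ min ((n : ℝ) / ⌊(n : ℝ) * s₀⌋₊) ((n : ℝ) / ((n : ℝ) - ⌊(n : ℝ) * s₀⌋₊)) *
            |(⌊(n : ℝ) * s⌋₊ : ℝ) / n - (⌊(n : ℝ) * s₀⌋₊ : ℝ) / n| := by
  have hmono : ∀ a b : ℝ, a ≤ b → (⌊(n : ℝ) * a⌋₊ : ℝ) ≤ (⌊(n : ℝ) * b⌋₊ : ℝ) := by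
    intro a b hab
    exact_mod_cast Nat.floor_mono (mul_le_mul_of_nonneg_left hab (Nat.cast_nonneg n))
  have hk : (0 : ℝ) < (⌊(n : ℝ) * s₀⌋₊ : ℝ) := by exact_mod_cast hfloor_pos
  have hkn : (⌊(n : ℝ) * s₀⌋₊ : ℝ) < n := by exact_mod_cast hfloor_lt
  have hm1 : ∀ s : ℝ, s ≤ s₀ → (⌊(n : ℝ) * s⌋₊ : ℝ) ≤ (⌊(n : ℝ) * s₀⌋₊ : ℝ) :=
    fun s h => hmono s s₀ h
  have hm2 : ∀ s : ℝ, s₀ ≤ s → (⌊(n : ℝ) * s₀⌋₊ : ℝ) ≤ (⌊(n : ℝ) * s⌋₊ : ℝ) :=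
    fun s h => hmono s₀ s h
  have h0 := hΔn s₀
  rw [if_pos le_rfl] at h0
  generalize (⌊(n : ℝ) * s₀⌋₊ : ℝ) = k at *
  have hn : (0 : ℝ) < n := hk.trans hkn
  have hd : (0 : ℝ) < n - k := sub_pos.2 hkn
  refine ⟨by rw [h0]; positivity, fun s _ => ⟨?_, ?_⟩⟩
  · have h1 := hΔn s
    by_cases hs : s ≤ s₀
    · rw [if_pos hs] at h1
      have hm := hm1 s hs
      generalize (⌊(n : ℝ) * s⌋₊ : ℝ) = m at *
      have e : 1 - Δn s / Δn s₀ = n / k * |m / n - k / n| := by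
        rw [abs_of_nonpos (sub_nonpos.2 (div_le_div_of_nonneg_right hm hn.le)), h1, h0]
        field_simp
        ring
      rw [e]
      exact mul_le_mul_of_nonneg_right (min_le_left _ _) (abs_nonneg _)
    · rw [if_neg hs] at h1
      have hm := hm2 s (not_le.1 hs).le
      generalize (⌊(n : ℝ) * s⌋₊ : ℝ) = m at *
      have e : 1 - Δn s / Δn s₀ = n / (n - k) * |m / n - k / n| := by
        rw [abs_of_nonneg (sub_nonneg.2 (div_le_div_of_nonneg_right hm hn.le)), h1, h0]
        field_simp
        ring
      rw [e]
      exact mul_le_mul_of_nonneg_right (min_le_right _ _) (abs_nonneg _)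
  · refine le_mul_of_one_le_left (abs_nonneg _) (le_min ?_ ?_)
    · rw [le_div_iff₀ hk]; linarith
    · rw [le_div_iff₀ hd]; linarith
end

section
/- Let V be a real normed vector space, S a set, T, A : S → V, λ : S → ℝ, and D ∈ V such that T(s) = A(s) + λ(s)·D for all s ∈ S. Fix s₀ ∈ S with λ(s₀) > 0 and suppose 0 ≤ λ(s) ≤ λ(s₀) for all s ∈ S. Then for every s ∈ S: ‖T(s)‖ − ‖T(s₀)‖ ≤ ‖A(s) − A(s₀)‖ + (λ(s)/λ(s₀) − 1)·( ‖T(s₀)‖ − ‖A(s₀)‖ ). -/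
/-- Abstract normed-space inequality underlying the proof of the rate of convergence: if
`T(s) = A(s) + λ(s)·D` with `0 ≤ λ(s) ≤ λ(s₀)` and `λ(s₀) > 0`, then
`‖T(s)‖ − ‖T(s₀)‖ ≤ ‖A(s) − A(s₀)‖ + (λ(s)/λ(s₀) − 1)(‖T(s₀)‖ − ‖A(s₀)‖)`. -/
theorem norm_decomposition_inequality {V : Type*} [NormedAddCommGroup V] [NormedSpace ℝ V]
    {S : Type*} (T A : S → V) (lam : S → ℝ) (D : V)
    (hT : ∀ s, T s = A s + lam s • D)
    (s₀ : S) (hpos : 0 < lam s₀) (hle : ∀ s, 0 ≤ lam s ∧ lam s ≤ lam s₀) :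
    ∀ s, ‖T s‖ - ‖T s₀‖ ≤
      ‖A s - A s₀‖ + (lam s / lam s₀ - 1) * (‖T s₀‖ - ‖A s₀‖) := by
  intro s
  obtain ⟨h0, h1⟩ := hle s
  obtain ⟨r, hr⟩ : ∃ r, r = lam s / lam s₀ := ⟨_, rfl⟩
  have hr0 : 0 ≤ r := hr ▸ div_nonneg h0 hpos.le
  have hr1 : r ≤ 1 := hr ▸ (div_le_one hpos).2 h1
  have hl : lam s = r * lam s₀ := by rw [hr]; field_simp
  have key : T s = (A s - A s₀) + r • T s₀ + (1 - r) • A s₀ := by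
    rw [hT s, hT s₀, hl]; module
  have hn : ‖T s‖ ≤ ‖A s - A s₀‖ + ‖r • T s₀‖ + ‖(1 - r) • A s₀‖ := by
    rw [key]; exact norm_add₃_le
  rw [norm_smul, norm_smul, Real.norm_of_nonneg hr0,
    Real.norm_of_nonneg (sub_nonneg.2 hr1)] at hn
  rw [← hr]
  linarith
end

section
/- Let V be a real normed vector space, S a set, T, A : S → V, λ : S → ℝ, and D ∈ V such that T(s) = A(s) + λ(s)·D for all s ∈ S. Fix s₀ ∈ S with λ(s₀) > 0 and suppose 0 ≤ λ(s) ≤ λ(s₀) for all s ∈ S. If ŝ ∈ S satisfies ‖T(ŝ)‖ ≥ ‖T(s₀)‖, then ‖A(ŝ) − A(s₀)‖ ≥ (1 − λ(ŝ)/λ(s₀)) · ( λ(s₀)·‖D‖ − 2·‖A(s₀)‖ ). -/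
/-- Abstract normed-space inequality underlying the proof of the rate of convergence: if
`T(s) = A(s) + λ(s)·D` with `0 ≤ λ(s) ≤ λ(s₀)`, `λ(s₀) > 0`, and `ŝ` satisfies
`‖T(ŝ)‖ ≥ ‖T(s₀)‖`, then `‖A(ŝ) − A(s₀)‖ ≥ (1 − λ(ŝ)/λ(s₀))·(λ(s₀)‖D‖ − 2‖A(s₀)‖)`. -/
theorem norm_argmax_inequality {V : Type*} [NormedAddCommGroup V] [NormedSpace ℝ V]
    {S : Type*} (T A : S → V) (lam : S → ℝ) (D : V)
    (hT : ∀ s, T s = A s + lam s • D)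
    (s₀ : S) (hpos : 0 < lam s₀) (hle : ∀ s, 0 ≤ lam s ∧ lam s ≤ lam s₀)
    (shat : S) (hmax : ‖T s₀‖ ≤ ‖T shat‖) :
    (1 - lam shat / lam s₀) * (lam s₀ * ‖D‖ - 2 * ‖A s₀‖) ≤ ‖A shat - A s₀‖ := by
  obtain ⟨h0, h1⟩ := hle shat
  obtain ⟨r, hr⟩ : ∃ r, r = lam shat / lam s₀ := ⟨_, rfl⟩
  have hr0 : 0 ≤ r := by rw [hr]; positivity
  have hr1 : r ≤ 1 := by rw [hr]; exact (div_le_one hpos).2 h1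
  have hl : lam shat = r * lam s₀ := by rw [hr]; field_simp
  rw [← hr]
  have hdec : T shat = (A shat - A s₀) + r • T s₀ + (1 - r) • A s₀ := by
    rw [hT, hT, hl]; module
  have e1 : ‖T shat‖ ≤ ‖A shat - A s₀‖ + r * ‖T s₀‖ + (1 - r) * ‖A s₀‖ := by
    rw [hdec]
    refine norm_add₃_le.trans (le_of_eq ?_)
    rw [norm_smul, norm_smul, Real.norm_of_nonneg hr0, Real.norm_of_nonneg (sub_nonneg.2 hr1)]
  have e2 : lam s₀ * ‖D‖ ≤ ‖T s₀‖ + ‖A s₀‖ := by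
    have h : lam s₀ • D = T s₀ - A s₀ := by rw [hT]; module
    have h2 := norm_sub_le (T s₀) (A s₀)
    rwa [← h, norm_smul, Real.norm_of_nonneg hpos.le] at h2
  have e3 := mul_le_mul_of_nonneg_left e2 (sub_nonneg.2 hr1)
  nlinarith
end
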